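/- arXiv:2407.21680 — 3 statements merged into one kernel-verified Lean document; each statement's English description precedes it below -/
import Mathlib

section
/- For all natural numbers j and k, the identity j³·C(j+k−1, k) − (2j³ + 3j² + 2j)·C(j+k, k) + (j+1)³·C(j+k+1, k) = k³·C(j+k−1, j) − (2k³ + 3k² + 2k)·C(j+k, j) + (k+1)³·C(j+k+1, j) holds in ℝ. (This is the entrywise statement that the semi-infinite symmetric Pascal matrix T with entries T_{jk} = C(j+k, j) commutes with the semi-infinite Jacobi matrix J̃ having diagonal entries β_n = −2n³ − 3n² − 2n and off-diagonal entries α_n = n³ in positions (n−1,n) and (n,n−1).) -/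
theorem Nat.add_mul_choose_add_sub_one (j k : ℕ) :
    (j + k) * (j + k - 1).choose k = j * (j + k).choose k := by
  rcases Nat.eq_zero_or_pos (j + k) with h | h
  · obtain ⟨rfl, rfl⟩ := Nat.add_eq_zero_iff.mp h
    simp
  · have := Nat.choose_mul_succ_eq (j + k - 1) k
    rw [Nat.sub_add_cancel h, Nat.add_sub_cancel] at this
    linarith

theorem Nat.succ_mul_choose_add_add_one (j k : ℕ) :
    (j + 1) * (j + k + 1).choose k = (j + k + 1) * (j + k).choose k := by
  have := Nat.add_mul_choose_add_sub_one (j + 1) k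
  rw [show j + 1 + k = j + k + 1 by omega, Nat.add_sub_cancel] at this
  exact this.symm

/-- The semi-infinite symmetric Pascal matrix `T_{jk} = C(j+k, j)` commutes with the
semi-infinite Jacobi matrix `J̃` with diagonal `β_n = -2n³-3n²-2n` and off-diagonal
`α_n = n³`, stated entrywise. -/
theorem pascal_commutes_jacobi_cubic_entrywise (j k : ℕ) :
    (j : ℝ) ^ 3 * (Nat.choose (j + k - 1) k : ℝ)
      - (2 * (j : ℝ) ^ 3 + 3 * (j : ℝ) ^ 2 + 2 * (j : ℝ)) * (Nat.choose (j + k) k : ℝ)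
      + ((j : ℝ) + 1) ^ 3 * (Nat.choose (j + k + 1) k : ℝ)
  = (k : ℝ) ^ 3 * (Nat.choose (j + k - 1) j : ℝ)
      - (2 * (k : ℝ) ^ 3 + 3 * (k : ℝ) ^ 2 + 2 * (k : ℝ)) * (Nat.choose (j + k) j : ℝ)
      + ((k : ℝ) + 1) ^ 3 * (Nat.choose (j + k + 1) j : ℝ) := by
  rcases Nat.eq_zero_or_pos (j + k) with h | h
  · obtain ⟨rfl, rfl⟩ := Nat.add_eq_zero_iff.mp h
    simp
  have hj := Nat.add_mul_choose_add_sub_one j k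
  have hk := Nat.add_mul_choose_add_sub_one k j
  have hj' := Nat.succ_mul_choose_add_add_one j k
  have hk' := Nat.succ_mul_choose_add_add_one k j
  rw [Nat.add_comm k j] at hk hk'
  rw [← Nat.choose_symm_add] at hj hj' ⊢
  have hne : (j : ℝ) + k ≠ 0 := by exact_mod_cast h.ne'
  apply_fun ((↑) : ℕ → ℝ) at hj hk hj' hk'
  push_cast at hj hk hj' hk'
  apply mul_left_cancel₀ hne
  linear_combination (j : ℝ) ^ 3 * hj - (k : ℝ) ^ 3 * hk
    + ((j : ℝ) + k) * ((j : ℝ) + 1) ^ 2 * hj' - ((j : ℝ) + k) * ((k : ℝ) + 1) ^ 2 * hk'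
end

section
/- For every natural number N, the matrix B_N := −Λ_N * J_N * Λ_N + (N² − 1)•1 commutes with the dual Pascal matrix S_N = Ψ_Nᵀ * Ψ_N: B_N * S_N = S_N * B_N. -/
open Matrix

/-- The `N × N` symmetric Pascal matrix, `(T_N)_{jk} = C(j+k, j)`. -/
noncomputable def pascalT (N : ℕ) : Matrix (Fin N) (Fin N) ℝ :=
  fun j k => (Nat.choose (j.1 + k.1) j.1 : ℝ)

/-- The `N × N` lower-triangular Pascal matrix, `(Ψ_N)_{jk} = C(j, k)`. -/
noncomputable def psiMat (N : ℕ) : Matrix (Fin N) (Fin N) ℝ :=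
  fun j k => (Nat.choose j.1 k.1 : ℝ)

/-- The `N × N` diagonal sign matrix `Λ_N = diag(1, -1, 1, …)`. -/
noncomputable def lamMat (N : ℕ) : Matrix (Fin N) (Fin N) ℝ :=
  Matrix.diagonal fun j => (-1 : ℝ) ^ j.1

/-- The `N × N` symmetric tridiagonal (Jacobi) matrix `J_N` with diagonal entries
`(J_N)_{jj} = -N²·j + 2j³ + 3j² + 2j` and off-diagonal entries
`(J_N)_{j,j+1} = (J_N)_{j+1,j} = (j+1)·(N² - (j+1)²)`. -/
noncomputable def jacobiJ (N : ℕ) : Matrix (Fin N) (Fin N) ℝ :=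
  fun j k =>
    if j.1 = k.1 then
      -((N : ℝ) ^ 2) * (j.1 : ℝ) + 2 * (j.1 : ℝ) ^ 3 + 3 * (j.1 : ℝ) ^ 2 + 2 * (j.1 : ℝ)
    else if j.1 + 1 = k.1 then (k.1 : ℝ) * ((N : ℝ) ^ 2 - (k.1 : ℝ) ^ 2)
    else if k.1 + 1 = j.1 then (j.1 : ℝ) * ((N : ℝ) ^ 2 - (j.1 : ℝ) ^ 2)
    else 0

/-- The entries of the Jacobi matrix applied to a sequence; the boundary term drops out because
the off-diagonal entry `j * (N ^ 2 - j ^ 2)` vanishes at `j = 0` and `j = N`. -/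
lemma sum_jacobiJ_mul (N : ℕ) (j : Fin N) (f : ℕ → ℝ) :
    ∑ m : Fin N, jacobiJ N j m * f m =
      (-((N : ℝ) ^ 2) * (j.1 : ℝ) + 2 * (j.1 : ℝ) ^ 3 + 3 * (j.1 : ℝ) ^ 2 + 2 * (j.1 : ℝ)) * f j
        + ((j.1 : ℝ) + 1) * ((N : ℝ) ^ 2 - ((j.1 : ℝ) + 1) ^ 2) * f (j + 1)
        + (j.1 : ℝ) * ((N : ℝ) ^ 2 - (j.1 : ℝ) ^ 2) * f (j - 1) := by
  obtain ⟨j, hj⟩ := j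
  have hsplit : ∀ m : ℕ, (if j = m then
        -((N : ℝ) ^ 2) * (j : ℝ) + 2 * (j : ℝ) ^ 3 + 3 * (j : ℝ) ^ 2 + 2 * (j : ℝ)
      else if j + 1 = m then (m : ℝ) * ((N : ℝ) ^ 2 - (m : ℝ) ^ 2)
      else if m + 1 = j then (j : ℝ) * ((N : ℝ) ^ 2 - (j : ℝ) ^ 2)
      else 0) * f m =
      (if j = m then
        (-((N : ℝ) ^ 2) * (j : ℝ) + 2 * (j : ℝ) ^ 3 + 3 * (j : ℝ) ^ 2 + 2 * (j : ℝ)) * f j else 0)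
      + (if j + 1 = m then
        ((j : ℝ) + 1) * ((N : ℝ) ^ 2 - ((j : ℝ) + 1) ^ 2) * f (j + 1) else 0)
      + (if j - 1 = m then (j : ℝ) * ((N : ℝ) ^ 2 - (j : ℝ) ^ 2) * f (j - 1) else 0) := by
    intro m
    rcases Nat.eq_zero_or_pos j with rfl | hpos
    · by_cases h0 : 0 = m
      · subst h0; simp
      · by_cases h1 : 0 + 1 = m
        · subst h1; simp
        · simp [h0, h1]
    · by_cases h0 : j = m
      · subst h0; simp [show j - 1 ≠ j by omega]
      · by_cases h1 : j + 1 = m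
        · subst h1; simp [show j - 1 ≠ j + 1 by omega]
        · by_cases h2 : m + 1 = j
          · subst h2; simp [show m + 1 + 1 ≠ m by omega]
          · simp [h0, h1, h2, show j - 1 ≠ m by omega]
  simp only [jacobiJ]
  rw [Fin.sum_univ_eq_sum_range (fun m => (if j = m then
        -((N : ℝ) ^ 2) * (j : ℝ) + 2 * (j : ℝ) ^ 3 + 3 * (j : ℝ) ^ 2 + 2 * (j : ℝ)
      else if j + 1 = m then (m : ℝ) * ((N : ℝ) ^ 2 - (m : ℝ) ^ 2)
      else if m + 1 = j then (j : ℝ) * ((N : ℝ) ^ 2 - (j : ℝ) ^ 2)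
      else 0) * f m) N, Finset.sum_congr rfl fun m _ => hsplit m]
  simp only [Finset.sum_add_distrib, Finset.sum_ite_eq, Finset.mem_range, hj, if_true,
    show j - 1 < N by omega]
  congr 2
  split_ifs with h
  · rfl
  · obtain rfl : N = j + 1 := by omega
    push_cast
    ring

/-- Multiplying by the absorption factor, `j C(j+k-1, j-1)` is proportional to `C(j+k, j)`. -/
lemma add_mul_mul_choose_pred (j k : ℕ) :
    ((j : ℝ) + k) * (j * (Nat.choose (j - 1 + k) (j - 1) : ℝ)) =
      (j : ℝ) ^ 2 * (Nat.choose (j + k) j : ℝ) := by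
  cases j with
  | zero => simp
  | succ a =>
    have h : (((a + k + 1) * (a + k).choose a : ℕ) : ℝ) = _ :=
      congrArg Nat.cast (Nat.add_one_mul_choose_eq (a + k) a)
    rw [show a + k + 1 = a + 1 + k by ring] at h
    push_cast at h
    push_cast
    linear_combination ((a : ℝ) + 1) * h

lemma succ_mul_choose_add_succ (j k : ℕ) :
    ((j : ℝ) + 1) * (Nat.choose (j + 1 + k) (j + 1) : ℝ) =
      ((j : ℝ) + k + 1) * (Nat.choose (j + k) j : ℝ) := by
  have h : (((j + k + 1) * (j + k).choose j : ℕ) : ℝ) = _ :=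
    congrArg Nat.cast (Nat.add_one_mul_choose_eq (j + k) j)
  rw [show j + k + 1 = j + 1 + k by ring] at h
  push_cast at h
  linear_combination -h

lemma jacobiJ_transpose (N : ℕ) : (jacobiJ N)ᵀ = jacobiJ N := by
  ext j k
  simp only [Matrix.transpose_apply, jacobiJ]
  split_ifs with h₁ h₂ h₃ <;> first | omega | rfl | simp_all

lemma pascalT_transpose (N : ℕ) : (pascalT N)ᵀ = pascalT N := by
  ext j k
  simp only [Matrix.transpose_apply, pascalT]
  rw [Nat.choose_symm_add, add_comm]

/-- The Jacobi matrix commutes with the symmetric Pascal matrix. -/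
lemma jacobiJ_mul_pascalT (N : ℕ) : jacobiJ N * pascalT N = pascalT N * jacobiJ N := by
  have hT : pascalT N * jacobiJ N = (jacobiJ N * pascalT N)ᵀ := by
    rw [Matrix.transpose_mul, jacobiJ_transpose, pascalT_transpose]
  rw [hT]
  ext j k
  rw [Matrix.transpose_apply, Matrix.mul_apply, Matrix.mul_apply]
  simp only [pascalT]
  rw [sum_jacobiJ_mul N j fun m => (Nat.choose (m + k.1) m : ℝ),
    sum_jacobiJ_mul N k fun m => (Nat.choose (m + j.1) m : ℝ)]
  rcases eq_or_ne j k with rfl | hjk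
  · rfl
  have hne : ((j.1 : ℝ) + k.1) ≠ 0 := by
    have : j.1 ≠ k.1 := fun h => hjk (Fin.ext h)
    exact_mod_cast (show j.1 + k.1 ≠ 0 by omega)
  have hsymm : (Nat.choose (k.1 + j.1) k.1 : ℝ) = (Nat.choose (j.1 + k.1) j.1 : ℝ) := by
    rw [Nat.choose_symm_add, add_comm]
  have h₁ := succ_mul_choose_add_succ j.1 k.1
  have h₂ := succ_mul_choose_add_succ k.1 j.1
  have h₃ := add_mul_mul_choose_pred j.1 k.1
  have h₄ := add_mul_mul_choose_pred k.1 j.1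
  rw [hsymm] at h₂ h₄ ⊢
  apply mul_left_cancel₀ hne
  linear_combination ((j.1 : ℝ) + k.1) * ((N : ℝ) ^ 2 - ((j.1 : ℝ) + 1) ^ 2) * h₁
    - ((j.1 : ℝ) + k.1) * ((N : ℝ) ^ 2 - ((k.1 : ℝ) + 1) ^ 2) * h₂
    + ((N : ℝ) ^ 2 - (j.1 : ℝ) ^ 2) * h₃ - ((N : ℝ) ^ 2 - (k.1 : ℝ) ^ 2) * h₄

/-- Vandermonde's identity: the Cholesky factorization of the symmetric Pascal matrix. -/
lemma psiMat_mul_transpose (N : ℕ) : psiMat N * (psiMat N)ᵀ = pascalT N := by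
  ext j k
  simp only [Matrix.mul_apply, Matrix.transpose_apply, psiMat, pascalT]
  rw [Fin.sum_univ_eq_sum_range (fun m => (Nat.choose j.1 m : ℝ) * (Nat.choose k.1 m : ℝ)) N,
    add_comm j.1, Nat.add_choose_eq, Finset.Nat.sum_antidiagonal_eq_sum_range_succ_mk]
  push_cast
  symm
  rw [← Finset.sum_subset (Finset.range_mono (show j.1 + 1 ≤ N from j.2))]
  · refine Finset.sum_congr rfl fun m hm => ?_
    rw [Nat.choose_symm (by simpa [Nat.lt_succ_iff] using hm), mul_comm]
  · intro m _ hm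
    rw [Nat.choose_eq_zero_of_lt (by simpa using hm)]
    simp

/-- Binomial inversion: `Λ Ψ` is an involution. -/
lemma psiMat_mul_lamMat_mul_psiMat (N : ℕ) : psiMat N * lamMat N * psiMat N = lamMat N := by
  ext j k
  rw [Matrix.mul_apply]
  simp only [lamMat, Matrix.mul_diagonal, psiMat, Matrix.diagonal_apply]
  rw [Fin.sum_univ_eq_sum_range
    (fun m => (Nat.choose j.1 m : ℝ) * (-1) ^ m * (Nat.choose m k.1 : ℝ)) N]
  obtain ⟨j, hj⟩ := j
  obtain ⟨k, hk⟩ := k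
  simp only [Fin.mk.injEq]
  rcases lt_or_ge j k with h | h
  · rw [if_neg h.ne]
    refine Finset.sum_eq_zero fun m _ => ?_
    rcases lt_or_ge j m with hm | hm
    · simp [Nat.choose_eq_zero_of_lt hm]
    · simp [Nat.choose_eq_zero_of_lt (hm.trans_lt h)]
  · obtain ⟨d, rfl⟩ := Nat.exists_eq_add_of_le h
    have hsub : Finset.Ico k (k + d + 1) ⊆ Finset.range N := by
      intro m
      simp only [Finset.mem_Ico, Finset.mem_range]
      omega
    rw [← Finset.sum_subset hsub]
    · rw [Finset.sum_Ico_eq_sum_range, show k + d + 1 - k = d + 1 by omega]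
      have halt : ∑ i ∈ Finset.range (d + 1), (-1 : ℝ) ^ i * (Nat.choose d i : ℝ) =
          if d = 0 then 1 else 0 := by
        exact_mod_cast congrArg (Int.cast : ℤ → ℝ) (Int.alternating_sum_range_choose (n := d))
      have hterm : ∀ i, (Nat.choose (k + d) (k + i) : ℝ) * (-1) ^ (k + i)
          * (Nat.choose (k + i) k : ℝ) =
          (-1) ^ k * (Nat.choose (k + d) k : ℝ) * ((-1 : ℝ) ^ i * (Nat.choose d i : ℝ)) := by
        intro i
        have h := Nat.choose_mul (n := k + d) (Nat.le_add_right k i)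
        rw [Nat.add_sub_cancel_left, Nat.add_sub_cancel_left] at h
        have h' : (Nat.choose (k + d) (k + i) : ℝ) * (Nat.choose (k + i) k : ℝ) =
          (Nat.choose (k + d) k : ℝ) * (Nat.choose d i : ℝ) := by exact_mod_cast h
        rw [pow_add]
        linear_combination (-1 : ℝ) ^ k * (-1) ^ i * h'
      simp only [hterm]
      rw [← Finset.mul_sum, halt]
      rcases Nat.eq_zero_or_pos d with rfl | hd
      · simp
      · simp [hd.ne']
    · intro m _ hm
      rcases lt_or_ge m k with hmk | hmk
      · simp [Nat.choose_eq_zero_of_lt hmk]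
      · simp only [Finset.mem_Ico, not_and, not_lt] at hm
        simp [Nat.choose_eq_zero_of_lt (show k + d < m by have := hm hmk; omega)]

lemma lamMat_mul_self (N : ℕ) : lamMat N * lamMat N = 1 := by
  simp [lamMat, Matrix.diagonal_mul_diagonal, ← mul_pow]

/-- The dual Pascal matrix is the inverse of the symmetric Pascal matrix up to signs. -/
lemma dualPascal_mul_conj_pascalT (N : ℕ) :
    ((psiMat N)ᵀ * psiMat N) * (lamMat N * pascalT N * lamMat N) = 1 := by
  have hΛ : (lamMat N)ᵀ = lamMat N := Matrix.diagonal_transpose _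
  have hdual : (psiMat N)ᵀ * lamMat N * (psiMat N)ᵀ = lamMat N := by
    simpa [Matrix.mul_assoc, hΛ] using
      congrArg Matrix.transpose (psiMat_mul_lamMat_mul_psiMat N)
  calc _ = (psiMat N)ᵀ * (psiMat N * lamMat N * psiMat N) * (psiMat N)ᵀ * lamMat N := by
        rw [← psiMat_mul_transpose]; simp only [Matrix.mul_assoc]
    _ = 1 := by rw [psiMat_mul_lamMat_mul_psiMat, hdual, lamMat_mul_self]

/-- The matrix `B_N = -Λ_N J_N Λ_N + (N² - 1)·I` commutes with the dual Pascal matrix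
`S_N = Ψ_Nᵀ Ψ_N`. -/
theorem dual_jacobi_commutes_dual_pascal (N : ℕ) :
    (-(lamMat N * jacobiJ N * lamMat N) + ((N : ℝ) ^ 2 - 1) • (1 : Matrix (Fin N) (Fin N) ℝ))
        * ((psiMat N)ᵀ * psiMat N)
      = ((psiMat N)ᵀ * psiMat N)
        * (-(lamMat N * jacobiJ N * lamMat N) + ((N : ℝ) ^ 2 - 1) • 1) := by
  have hright := dualPascal_mul_conj_pascalT N
  have hleft := mul_eq_one_comm.mp hright
  have hΛ := lamMat_mul_self N
  have hcomm : Commute (lamMat N * jacobiJ N * lamMat N) (lamMat N * pascalT N * lamMat N) := by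
    have h : ∀ A B : Matrix (Fin N) (Fin N) ℝ,
        lamMat N * A * lamMat N * (lamMat N * B * lamMat N) = lamMat N * (A * B) * lamMat N := by
      intro A B
      calc _ = lamMat N * A * (lamMat N * lamMat N) * B * lamMat N := by
            simp only [Matrix.mul_assoc]
        _ = _ := by rw [hΛ, Matrix.mul_one]; simp only [Matrix.mul_assoc]
    rw [Commute, SemiconjBy, h, h, jacobiJ_mul_pascalT]
  have hinv : Commute (lamMat N * jacobiJ N * lamMat N) ((psiMat N)ᵀ * psiMat N) :=
    Commute.units_inv_right (u := ⟨_, _, hleft, hright⟩) hcomm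
  exact (hinv.neg_left.add_left ((Commute.one_left _).smul_left _)).eq
end

section
/- Let N be a natural number and let A, R : Matrix (Fin N) (Fin N) ℝ satisfy A * Ψ_N = Ψ_N * Rᵀ. Then A commutes with the Pascal matrix T_N = Ψ_N * Ψ_Nᵀ (i.e. A * T_N = T_N * A) if and only if Aᵀ * Ψ_N = Ψ_N * R. -/
open Matrix

/-- A form of the Vandermonde identity, summed over any range that contains the support. -/
theorem sum_range_choose_mul_choose {N j : ℕ} (k : ℕ) (hj : j < N) :
    ∑ i ∈ Finset.range N, j.choose i * k.choose i = (j + k).choose j := by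
  rw [add_comm j k, Nat.add_choose_eq, Finset.Nat.sum_antidiagonal_eq_sum_range_succ_mk]
  symm
  refine Finset.sum_subset_zero_on_sdiff (Finset.range_subset_range.2 hj) (fun i hi => ?_)
    (fun i hi => ?_)
  · simp only [Finset.mem_sdiff, Finset.mem_range, not_lt] at hi
    rw [Nat.choose_eq_zero_of_lt hi.2, zero_mul]
  · have hij : i ≤ j := Nat.lt_succ_iff.1 (Finset.mem_range.1 hi)
    rw [Nat.choose_symm hij, mul_comm]

theorem pascalT_eq_psiMat_mul_transpose (N : ℕ) : pascalT N = psiMat N * (psiMat N)ᵀ := by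
  ext j k
  simp only [pascalT, psiMat, Matrix.mul_apply, Matrix.transpose_apply]
  rw [Fin.sum_univ_eq_sum_range (fun i => (j.1.choose i : ℝ) * (k.1.choose i : ℝ)) N,
    ← sum_range_choose_mul_choose k.1 j.2]
  push_cast
  rfl

theorem det_psiMat (N : ℕ) : (psiMat N).det = 1 := by
  rw [Matrix.det_of_isLowerTriangular]
  · simp [psiMat]
  · intro j k hjk
    exact Nat.cast_eq_zero.2 (Nat.choose_eq_zero_of_lt hjk)

theorem isUnit_psiMat (N : ℕ) : IsUnit (psiMat N) := by
  simp [Matrix.isUnit_iff_isUnit_det, det_psiMat]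

/-- Commutation criterion via the Fourier map, in finite-matrix form: if `A Ψ_N = Ψ_N Rᵀ`,
then `A` commutes with `T_N = Ψ_N Ψ_Nᵀ` if and only if `Aᵀ Ψ_N = Ψ_N R`. -/
theorem commutes_with_pascal_iff (N : ℕ) (A R : Matrix (Fin N) (Fin N) ℝ)
    (h : A * psiMat N = psiMat N * Rᵀ) :
    A * pascalT N = pascalT N * A ↔ Aᵀ * psiMat N = psiMat N * R := by
  rw [pascalT_eq_psiMat_mul_transpose, ← Matrix.mul_assoc, h, Matrix.mul_assoc, Matrix.mul_assoc,
    (isUnit_psiMat N).mul_right_inj, ← Matrix.transpose_inj]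
  simp only [Matrix.transpose_mul, Matrix.transpose_transpose]
  exact eq_comm
end
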